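/- Let ν, μ, k, ξ₀ be real with ν ≠ 0 and ν k² = −μ/19, and set A = 450 μ³/(19³ ν) and b = 0. Define τ(ξ) = (k/2) tanh( k(ξ−ξ₀)/2 ) and u(ξ) = 120ν τ³ − 15b τ² + (60μ/19 − 30ν k² − 15b²/(76ν)) τ + (5/2) b k² − 13 b³/(608 ν²) + 7 μ b/(76 ν). Then u satisfies the KS travelling-wave ODE ν u''' + b u'' + μ u' + u²/2 + A = 0 for all real ξ. -/

import Mathlib

theorem Real.hasDerivAt_tanh_one_sub_sq (x : ℝ) :
    HasDerivAt Real.tanh (1 - Real.tanh x ^ 2) x := by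
  have hc : Real.cosh x ≠ 0 := (Real.cosh_pos x).ne'
  have h := (Real.hasDerivAt_sinh x).div (Real.hasDerivAt_cosh x) hc
  have hfun : Real.tanh = Real.sinh / Real.cosh := by
    ext y
    exact Real.tanh_eq_sinh_div_cosh y
  rw [hfun]
  refine h.congr_deriv ?_
  simp only [Pi.div_apply]
  field_simp

/-- The Riccati equation `τ' = k²/4 - τ²`. -/
theorem hasDerivAt_half_mul_tanh (k ξ₀ ξ : ℝ) :
    HasDerivAt (fun x => k / 2 * Real.tanh (k * (x - ξ₀) / 2))
      (k ^ 2 / 4 - (k / 2 * Real.tanh (k * (ξ - ξ₀) / 2)) ^ 2) ξ := by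
  have hin : HasDerivAt (fun x => k * (x - ξ₀) / 2) (k * 1 / 2) ξ :=
    (((hasDerivAt_id ξ).sub_const ξ₀).const_mul k).div_const 2
  refine (((Real.hasDerivAt_tanh_one_sub_sq _).comp ξ hin).const_mul (k / 2)).congr_deriv ?_
  ring

/-- The derivative of a polynomial in a function solving the Riccati equation `τ' = c - τ²`. -/
theorem deriv_eval_of_riccati {τ : ℝ → ℝ} {c : ℝ}
    (hτ : ∀ x, HasDerivAt τ (c - τ x ^ 2) x) (p : Polynomial ℝ) :
    deriv (fun x => p.eval (τ x)) =
      fun x => (p.derivative * (Polynomial.C c - Polynomial.X ^ 2)).eval (τ x) := by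
  ext x
  simpa [Function.comp_def] using ((p.hasDerivAt (τ x)).comp x (hτ x)).deriv


/-- Second Kuramoto–Tsuzuki trigonometric solution of KS (b = 0). The third-degree polynomial in
`τ(ξ) = (k/2) tanh(k(ξ-ξ₀)/2)` satisfies the Kuramoto–Sivashinsky
travelling-wave ODE `ν u''' + b u'' + μ u' + u²/2 + A = 0` for all real ξ. -/
theorem ks_trig_solution_2 (ν b μ A k ξ₀ : ℝ) (hν : ν ≠ 0)
    (hk : ν * k ^ 2 = -μ / 19) (hA : A = 450 * μ ^ 3 / (19 ^ 3 * ν))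
    (hb : b = 0)
    (τ : ℝ → ℝ) (hτ : ∀ ξ : ℝ, τ ξ = k / 2 * Real.tanh (k * (ξ - ξ₀) / 2))
    (u : ℝ → ℝ)
    (hu : ∀ ξ : ℝ, u ξ = 120 * ν * (τ ξ) ^ 3 - 15 * b * (τ ξ) ^ 2
      + (60 * μ / 19 - 30 * ν * k ^ 2 - 15 * b ^ 2 / (76 * ν)) * τ ξ
      + 5 / 2 * b * k ^ 2 - 13 * b ^ 3 / (608 * ν ^ 2)
      + 7 * μ * b / (76 * ν)) :
    ∀ ξ : ℝ,
      ν * deriv (deriv (deriv u)) ξ + b * deriv (deriv u) ξ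
      + μ * deriv u ξ + (u ξ) ^ 2 / 2 + A = 0 := by
  intro ξ
  subst hb
  have hμ : μ = -19 * (ν * k ^ 2) := by linarith
  subst hμ
  have hA' : A = -450 * ν ^ 2 * k ^ 6 := by
    rw [hA]
    field_simp
  have hτ' : ∀ x, HasDerivAt τ (k ^ 2 / 4 - τ x ^ 2) x := by
    rw [funext hτ]
    exact hasDerivAt_half_mul_tanh k ξ₀
  have hu' : u = fun x => (Polynomial.C (120 * ν) * Polynomial.X ^ 3
      - Polynomial.C (90 * ν * k ^ 2) * Polynomial.X : Polynomial ℝ).eval (τ x) := by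
    ext x
    simp only [hu, Polynomial.eval_sub, Polynomial.eval_mul, Polynomial.eval_C,
      Polynomial.eval_pow, Polynomial.eval_X]
    ring
  rw [hA', hu']
  simp only [deriv_eval_of_riccati hτ']
  simp [Polynomial.derivative_pow]
  ring
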